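/- For all f, g ∈ L with f(P) + g(P) ≤ 1 for every P ∈ S (i.e. f and g are orthogonal), the pointwise sum f + g belongs to L, and f + g is the least upper bound of f and g in L: f ≤ f+g, g ≤ f+g, and every h ∈ L with f ≤ h and g ≤ h pointwise on S satisfies f+g ≤ h. Thus in the logic L the sum f ⊕ g of orthogonal questions equals their join f ∨ g. -/

import Mathlib

namespace BoxWorld

/-- A (2,2)-box assignment: `P a b α β` stands for `P(αβ|ab)`, where the measurement
settings are `a, b ∈ Fin 2` (with `x = 0`, `y = 1`) and the outcomes are `α, β ∈ Fin 2`. -/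
abbrev Box : Type := Fin 2 → Fin 2 → Fin 2 → Fin 2 → ℝ

/-- (P1) positivity, (P2) normalization, (P3) non-signalling. -/
def IsState (P : Box) : Prop :=
  (∀ a b α β, 0 ≤ P a b α β) ∧
  (∀ a b, ∑ α : Fin 2, ∑ β : Fin 2, P a b α β = 1) ∧
  (∀ a b b' α, ∑ β : Fin 2, P a b α β = ∑ β : Fin 2, P a b' α β) ∧
  (∀ a a' b β, ∑ α : Fin 2, P a b α β = ∑ α : Fin 2, P a' b α β)

/-- The set `S` of (2,2)-box states, as a subtype. -/
abbrev State : Type := {P : Box // IsState P}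

/-- The elementary question `e[ab, αβ]`, as a functional on states. -/
def elem (a b α β : Fin 2) : State → ℝ := fun P => P.1 a b α β

abbrev Idx : Type := Fin 2 × Fin 2 × Fin 2 × Fin 2

def elemI (i : Idx) : State → ℝ := elem i.1 i.2.1 i.2.2.1 i.2.2.2

/-- The logic `L` of the (2,2)-box world: all functionals `f = Σ_{e ∈ A} e`, where `A` is a
set of elementary questions whose pointwise sum is `≤ 1` at every state, together with the
complements `1 - f` of all such functionals. -/
def InLogic (f : State → ℝ) : Prop :=
  (∃ A : Finset Idx, (∀ P : State, ∑ i ∈ A, elemI i P ≤ 1) ∧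
      f = fun P => ∑ i ∈ A, elemI i P) ∨
  (∃ A : Finset Idx, (∀ P : State, ∑ i ∈ A, elemI i P ≤ 1) ∧
      f = fun P => 1 - ∑ i ∈ A, elemI i P)

/-- Two elementary questions are exclusive if they share a measurement setting on one side
with different outcomes on that side. -/
def Exclusive (i j : Idx) : Prop :=
  (i.1 = j.1 ∧ i.2.2.1 ≠ j.2.2.1) ∨ (i.2.1 = j.2.1 ∧ i.2.2.2 ≠ j.2.2.2)

lemma Exclusive.symm {i j : Idx} (h : Exclusive i j) : Exclusive j i :=
  h.imp (fun h => ⟨h.1.symm, h.2.symm⟩) (fun h => ⟨h.1.symm, h.2.symm⟩)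

lemma Exclusive.ne {i j : Idx} (h : Exclusive i j) : i ≠ j := by
  rintro rfl
  exact h.elim (fun h => h.2 rfl) (fun h => h.2 rfl)

lemma elemI_nonneg (i : Idx) (P : State) : 0 ≤ elemI i P := P.2.1 _ _ _ _

lemma sum_elemI_nonneg (A : Finset Idx) (P : State) : 0 ≤ ∑ i ∈ A, elemI i P :=
  Finset.sum_nonneg fun i _ => elemI_nonneg i P

/-- The local deterministic state with responses `s` and `t`. -/
def detState (s t : Fin 2 → Fin 2) : State :=
  ⟨fun a b α β => (if α = s a then 1 else 0) * (if β = t b then 1 else 0), by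
    refine ⟨fun a b α β => ?_, fun a b => ?_, fun a b b' α => ?_, fun a a' b β => ?_⟩
    · dsimp only
      split_ifs <;> norm_num
    · simp
    · simp
    · simp⟩

lemma exists_state_of_not_exclusive {i j : Idx} (h : ¬ Exclusive i j) :
    ∃ P : State, elemI i P = 1 ∧ elemI j P = 1 := by
  obtain ⟨a, b, α, β⟩ := i
  obtain ⟨a', b', α', β'⟩ := j
  simp only [Exclusive, not_or, not_and, not_not] at h
  refine ⟨detState (fun x => if x = a then α else α') (fun x => if x = b then β else β'), ?_, ?_⟩
  · simp [elemI, elem, detState]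
  · have h₁ : (if a' = a then α else α') = α' := by
      split_ifs with h'
      exacts [h.1 h'.symm, rfl]
    have h₂ : (if b' = b then β else β') = β' := by
      split_ifs with h'
      exacts [h.2 h'.symm, rfl]
    simp [elemI, elem, detState, h₁, h₂]

lemma exclusive_of_sum_add_sum_le_one {A B : Finset Idx}
    (h : ∀ P : State, ∑ i ∈ A, elemI i P + ∑ i ∈ B, elemI i P ≤ 1)
    {i j : Idx} (hi : i ∈ A) (hj : j ∈ B) : Exclusive i j := by
  by_contra hij
  obtain ⟨P, hPi, hPj⟩ := exists_state_of_not_exclusive hij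
  have h₁ := Finset.single_le_sum (fun l _ => elemI_nonneg l P) hi
  have h₂ := Finset.single_le_sum (fun l _ => elemI_nonneg l P) hj
  linarith [h P]

lemma pairwise_exclusive_of_sum_le_one {A : Finset Idx}
    (h : ∀ P : State, ∑ i ∈ A, elemI i P ≤ 1) :
    (A : Set Idx).Pairwise Exclusive := by
  intro i hi j hj hij
  refine exclusive_of_sum_add_sum_le_one (A := {i}) (B := A.erase i) (fun P => ?_)
    (Finset.mem_singleton_self i) (Finset.mem_erase.2 ⟨hij.symm, hj⟩)
  rw [Finset.sum_singleton, Finset.add_sum_erase A (fun l => elemI l P) hi]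
  exact h P

/-- The test measuring `a` on the left, then choosing the right setting from the outcome. -/
def leftTest (a : Fin 2) (k : Fin 2 → Fin 2) : Finset Idx :=
  Finset.univ.image fun p : Fin 2 × Fin 2 => (a, k p.1, p.1, p.2)

/-- The test measuring `b` on the right, then choosing the left setting from the outcome. -/
def rightTest (b : Fin 2) (k : Fin 2 → Fin 2) : Finset Idx :=
  Finset.univ.image fun p : Fin 2 × Fin 2 => (k p.2, b, p.1, p.2)

lemma sum_leftTest (a : Fin 2) (k : Fin 2 → Fin 2) (P : State) :
    ∑ i ∈ leftTest a k, elemI i P = 1 := by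
  rw [leftTest, Finset.sum_image fun p _ q _ h => by
    simp only [Prod.mk.injEq] at h; exact Prod.ext h.2.2.1 h.2.2.2, Fintype.sum_prod_type]
  calc ∑ α, ∑ β, P.1 a (k α) α β = ∑ α, ∑ β, P.1 a 0 α β :=
        Finset.sum_congr rfl fun α _ => P.2.2.2.1 a (k α) 0 α
    _ = 1 := P.2.2.1 a 0

lemma sum_rightTest (b : Fin 2) (k : Fin 2 → Fin 2) (P : State) :
    ∑ i ∈ rightTest b k, elemI i P = 1 := by
  rw [rightTest, Finset.sum_image fun p _ q _ h => by
    simp only [Prod.mk.injEq] at h; exact Prod.ext h.2.2.1 h.2.2.2, Fintype.sum_prod_type_right]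
  calc ∑ β, ∑ α, P.1 (k β) b α β = ∑ β, ∑ α, P.1 0 b α β :=
        Finset.sum_congr rfl fun β _ => P.2.2.2.2 (k β) 0 b β
    _ = ∑ α, ∑ β, P.1 0 b α β := Finset.sum_comm
    _ = 1 := P.2.2.1 0 b

lemma subset_leftTest {A : Finset Idx} (hA : (A : Set Idx).Pairwise Exclusive) {a : Fin 2}
    (ha : ∀ i ∈ A, i.1 = a) : ∃ k, A ⊆ leftTest a k := by
  have hk : ∀ α, ∃ b, ∀ i ∈ A, i.2.2.1 = α → i.2.1 = b := by
    intro α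
    by_cases h : ∃ i ∈ A, i.2.2.1 = α
    · obtain ⟨i, hi, hα⟩ := h
      refine ⟨i.2.1, fun j hj hjα => ?_⟩
      by_cases hij : j = i
      · rw [hij]
      · exact (hA hj hi hij).elim (fun h => absurd (hjα.trans hα.symm) h.2) fun h => h.1
    · exact ⟨0, fun i hi hα => absurd ⟨i, hi, hα⟩ h⟩
  choose k hk using hk
  refine ⟨k, fun i hi => Finset.mem_image.2 ⟨i.2.2, Finset.mem_univ _, ?_⟩⟩
  rw [← hk _ i hi rfl, ← ha i hi]

lemma subset_rightTest {A : Finset Idx} (hA : (A : Set Idx).Pairwise Exclusive) {b : Fin 2}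
    (hb : ∀ i ∈ A, i.2.1 = b) : ∃ k, A ⊆ rightTest b k := by
  have hk : ∀ β, ∃ a, ∀ i ∈ A, i.2.2.2 = β → i.1 = a := by
    intro β
    by_cases h : ∃ i ∈ A, i.2.2.2 = β
    · obtain ⟨i, hi, hβ⟩ := h
      refine ⟨i.1, fun j hj hjβ => ?_⟩
      by_cases hij : j = i
      · rw [hij]
      · exact (hA hj hi hij).elim (fun h => h.1) fun h => absurd (hjβ.trans hβ.symm) h.2
    · exact ⟨0, fun i hi hβ => absurd ⟨i, hi, hβ⟩ h⟩
  choose k hk using hk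
  refine ⟨k, fun i hi => Finset.mem_image.2 ⟨i.2.2, Finset.mem_univ _, ?_⟩⟩
  rw [← hk _ i hi rfl, ← hb i hi]

lemma common_setting {A : Finset Idx} (hA : (A : Set Idx).Pairwise Exclusive) :
    (∃ a, ∀ i ∈ A, i.1 = a) ∨ ∃ b, ∀ i ∈ A, i.2.1 = b := by
  by_cases h : ∃ i ∈ A, ∃ j ∈ A, i.1 ≠ j.1
  · obtain ⟨i, hi, j, hj, hij⟩ := h
    have key : ∀ {l m : Idx}, l ∈ A → m ∈ A → l.1 ≠ m.1 → l.2.1 = m.2.1 := fun hl hm hlm =>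
      (hA hl hm fun h => hlm (congrArg Prod.fst h)).elim (fun h => absurd h.1 hlm) fun h => h.1
    refine Or.inr ⟨i.2.1, fun l hl => ?_⟩
    by_cases hli : l.1 = i.1
    · exact (key hl hj (hli ▸ hij)).trans (key hi hj hij).symm
    · exact key hl hi hli
  · push Not at h
    rcases A.eq_empty_or_nonempty with rfl | ⟨i, hi⟩
    · exact Or.inl ⟨0, by simp⟩
    · exact Or.inl ⟨i.1, fun j hj => h j hj i hi⟩

/-- Pairwise exclusive elementary questions extend to a set summing to `1`. -/
lemma exists_test_of_pairwise_exclusive {A : Finset Idx}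
    (hA : (A : Set Idx).Pairwise Exclusive) :
    ∃ M : Finset Idx, A ⊆ M ∧ ∀ P : State, ∑ i ∈ M, elemI i P = 1 := by
  rcases common_setting hA with ⟨a, ha⟩ | ⟨b, hb⟩
  · obtain ⟨k, hk⟩ := subset_leftTest hA ha
    exact ⟨_, hk, sum_leftTest a k⟩
  · obtain ⟨k, hk⟩ := subset_rightTest hA hb
    exact ⟨_, hk, sum_rightTest b k⟩

lemma sum_le_one_of_pairwise_exclusive {A : Finset Idx}
    (hA : (A : Set Idx).Pairwise Exclusive) (P : State) : ∑ i ∈ A, elemI i P ≤ 1 := by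
  obtain ⟨M, hM, hsum⟩ := exists_test_of_pairwise_exclusive hA
  exact (Finset.sum_le_sum_of_subset_of_nonneg hM fun i _ _ => elemI_nonneg i P).trans
    (hsum P).le

lemma exists_complement {A : Finset Idx} (hA : ∀ P : State, ∑ i ∈ A, elemI i P ≤ 1) :
    ∃ B : Finset Idx, ∀ P : State, ∑ i ∈ B, elemI i P = 1 - ∑ i ∈ A, elemI i P := by
  obtain ⟨M, hM, hsum⟩ :=
    exists_test_of_pairwise_exclusive (pairwise_exclusive_of_sum_le_one hA)
  refine ⟨M \ A, fun P => ?_⟩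
  rw [← hsum P, ← Finset.sum_sdiff hM, add_sub_cancel_right]

lemma InLogic.exists_sum {f : State → ℝ} (hf : InLogic f) :
    ∃ A : Finset Idx, ∀ P : State, f P = ∑ i ∈ A, elemI i P := by
  rcases hf with ⟨A, -, rfl⟩ | ⟨A, hA, rfl⟩
  · exact ⟨A, fun _ => rfl⟩
  · obtain ⟨B, hB⟩ := exists_complement hA
    exact ⟨B, fun P => (hB P).symm⟩

lemma InLogic.compl {f : State → ℝ} (hf : InLogic f) : InLogic fun P => 1 - f P := by
  rcases hf with ⟨A, hA, rfl⟩ | ⟨A, hA, rfl⟩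
  · exact Or.inr ⟨A, hA, rfl⟩
  · exact Or.inl ⟨A, hA, by simp⟩

lemma sum_union_of_sum_add_sum_le_one {A B : Finset Idx}
    (h : ∀ P : State, ∑ i ∈ A, elemI i P + ∑ i ∈ B, elemI i P ≤ 1) (P : State) :
    ∑ i ∈ A ∪ B, elemI i P = ∑ i ∈ A, elemI i P + ∑ i ∈ B, elemI i P :=
  Finset.sum_union <| Finset.disjoint_left.2 fun _ hA hB =>
    (exclusive_of_sum_add_sum_le_one h hA hB).ne rfl

/-- Pairwise orthogonal questions are jointly orthogonal. -/
lemma sum_add_sum_add_sum_le_one {A B C : Finset Idx}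
    (hAB : ∀ P : State, ∑ i ∈ A, elemI i P + ∑ i ∈ B, elemI i P ≤ 1)
    (hAC : ∀ P : State, ∑ i ∈ A, elemI i P + ∑ i ∈ C, elemI i P ≤ 1)
    (hBC : ∀ P : State, ∑ i ∈ B, elemI i P + ∑ i ∈ C, elemI i P ≤ 1) (P : State) :
    ∑ i ∈ A, elemI i P + ∑ i ∈ B, elemI i P + ∑ i ∈ C, elemI i P ≤ 1 := by
  have hcross : ∀ i ∈ A ∪ B, ∀ j ∈ C, Exclusive i j := by
    intro i hi j hj
    rcases Finset.mem_union.1 hi with hi | hi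
    · exact exclusive_of_sum_add_sum_le_one hAC hi hj
    · exact exclusive_of_sum_add_sum_le_one hBC hi hj
  have hABp : ((A ∪ B : Finset Idx) : Set Idx).Pairwise Exclusive :=
    pairwise_exclusive_of_sum_le_one fun Q => by
      rw [sum_union_of_sum_add_sum_le_one hAB]
      exact hAB Q
  have hCp : (C : Set Idx).Pairwise Exclusive :=
    pairwise_exclusive_of_sum_le_one fun Q => by
      linarith [hAC Q, sum_elemI_nonneg A Q]
  have hp : ((A ∪ B ∪ C : Finset Idx) : Set Idx).Pairwise Exclusive := by
    rw [Finset.coe_union, Set.pairwise_union]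
    exact ⟨hABp, hCp, fun i hi j hj _ => ⟨hcross i hi j hj, (hcross i hi j hj).symm⟩⟩
  have hle := sum_le_one_of_pairwise_exclusive hp P
  rwa [Finset.sum_union (Finset.disjoint_left.2 fun i hi hj => (hcross i hi i hj).ne rfl),
    sum_union_of_sum_add_sum_le_one hAB] at hle

/-- for orthogonal `f, g ∈ L` (i.e. `f + g ≤ 1` pointwise), the sum `f + g`
belongs to `L` and is the least upper bound (join) of `f` and `g` in `L`. -/
theorem orthogonal_sum_is_join (f g : State → ℝ) (hf : InLogic f) (hg : InLogic g)
    (horth : ∀ P : State, f P + g P ≤ 1) :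
    InLogic (fun P => f P + g P) ∧
    (∀ P : State, f P ≤ f P + g P) ∧
    (∀ P : State, g P ≤ f P + g P) ∧
    (∀ h : State → ℝ, InLogic h → (∀ P : State, f P ≤ h P) →
      (∀ P : State, g P ≤ h P) → ∀ P : State, f P + g P ≤ h P) := by
  obtain ⟨A, hA⟩ := hf.exists_sum
  obtain ⟨B, hB⟩ := hg.exists_sum
  have hAB : ∀ P : State, ∑ i ∈ A, elemI i P + ∑ i ∈ B, elemI i P ≤ 1 := fun P => by
    rw [← hA, ← hB]
    exact horth P
  have hU : ∀ P : State, ∑ i ∈ A ∪ B, elemI i P = f P + g P := fun P => by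
    rw [sum_union_of_sum_add_sum_le_one hAB, hA, hB]
  refine ⟨Or.inl ⟨A ∪ B, fun P => (hU P).trans_le (horth P), funext fun P => (hU P).symm⟩,
    fun P => ?_, fun P => ?_, fun h hh hfh hgh P => ?_⟩
  · linarith [hB P, sum_elemI_nonneg B P]
  · linarith [hA P, sum_elemI_nonneg A P]
  · obtain ⟨C, hC⟩ := hh.compl.exists_sum
    have hle := sum_add_sum_add_sum_le_one (C := C) hAB
      (fun Q => by linarith [hA Q, hC Q, hfh Q]) (fun Q => by linarith [hB Q, hC Q, hgh Q]) P
    linarith [hA P, hB P, hC P]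

end BoxWorld
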